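/- Let G be a virtually cyclic group, i.e., a group containing a cyclic subgroup of finite index. Then there exist an injective group homomorphism ψ : G → Homeo(C) such that ψ(g) is a prefix-exchange homeomorphism for every g ∈ G, and a finite binary word w such that for all g₁, g₂ ∈ G, ψ(g₁)(w*) ∩ ψ(g₂)(w*) ≠ ∅ if and only if g₁ = g₂. (In other words, every virtually cyclic group embeds as a demonstrative subgroup of Thompson's group V with a demonstration node.) -/

import Mathlib

/-- The Cantor space `C = ℕ → Bool` with the product topology. -/
abbrev Cantor : Type := ℕ → Bool

/-- The sequence `u · y` beginning with the letters of the finite word `u` and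
continuing with `y`. -/
def appendSeq (u : List Bool) (y : Cantor) : Cantor :=
  fun n => if h : n < u.length then u.get ⟨n, h⟩ else y (n - u.length)

/-- The cylinder `u*`: all sequences of the form `u · y`. -/
def cylinder (u : List Bool) : Set Cantor :=
  Set.range (appendSeq u)

/-- The group of homeomorphisms of the Cantor space, with composition as
multiplication (`(f * g) x = f (g x)`). -/
instance : Group (Cantor ≃ₜ Cantor) where
  mul f g := g.trans f
  one := Homeomorph.refl _
  inv := Homeomorph.symm
  mul_assoc _ _ _ := Homeomorph.ext fun _ => rfl
  one_mul _ := Homeomorph.ext fun _ => rfl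
  mul_one _ := Homeomorph.ext fun _ => rfl
  inv_mul_cancel f := Homeomorph.ext fun x => f.symm_apply_apply x

/-- A homeomorphism of the Cantor space is a prefix-exchange homeomorphism if it is
given by finitely many prefix substitutions `uᵢ · y ↦ vᵢ · y`, where the cylinders
`uᵢ*` partition `C` and the cylinders `vᵢ*` partition `C`. -/
def IsPrefixExchange (f : Cantor ≃ₜ Cantor) : Prop :=
  ∃ n : ℕ, 1 ≤ n ∧ ∃ u v : Fin n → List Bool,
    (Set.univ : Set (Fin n)).PairwiseDisjoint (fun i => cylinder (u i)) ∧
    (⋃ i, cylinder (u i)) = Set.univ ∧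
    (Set.univ : Set (Fin n)).PairwiseDisjoint (fun i => cylinder (v i)) ∧
    (⋃ i, cylinder (v i)) = Set.univ ∧
    ∀ (i : Fin n) (y : Cantor), f (appendSeq (u i) y) = appendSeq (v i) y


lemma appendSeq_nil (y : Cantor) : appendSeq [] y = y := by
  funext n
  simp [appendSeq]

lemma appendSeq_cons_zero (b : Bool) (u : List Bool) (y : Cantor) :
    appendSeq (b :: u) y 0 = b := by
  simp [appendSeq]

lemma appendSeq_cons_succ (b : Bool) (u : List Bool) (y : Cantor) (n : ℕ) :
    appendSeq (b :: u) y (n + 1) = appendSeq u y n := by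
  simp [appendSeq]

lemma appendSeq_cons_inj {b c : Bool} {u v : List Bool} {x y : Cantor} :
    appendSeq (b :: u) x = appendSeq (c :: v) y ↔ b = c ∧ appendSeq u x = appendSeq v y := by
  refine ⟨fun h => ⟨?_, funext fun n => ?_⟩, fun ⟨h₁, h₂⟩ => funext fun n => ?_⟩
  · simpa only [appendSeq_cons_zero] using congrFun h 0
  · simpa only [appendSeq_cons_succ] using congrFun h (n + 1)
  · cases n with
    | zero => simpa only [appendSeq_cons_zero] using h₁
    | succ n => simpa only [appendSeq_cons_succ] using congrFun h₂ n

lemma appendSeq_append (u v : List Bool) (y : Cantor) :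
    appendSeq (u ++ v) y = appendSeq u (appendSeq v y) := by
  induction u with
  | nil => rw [List.nil_append, appendSeq_nil]
  | cons b u ih => exact appendSeq_cons_inj.2 ⟨rfl, ih⟩

lemma appendSeq_injective (u : List Bool) : Function.Injective (appendSeq u) := by
  intro x y h
  induction u with
  | nil => simpa only [appendSeq_nil] using h
  | cons b u ih => exact ih (appendSeq_cons_inj.1 h).2

/-- If a sequence begins with both `u` and `p`, and `p` is not longer than `u`, then `u`
extends `p`. -/
lemma exists_eq_append_of_appendSeq_eq {p u : List Bool} {x y : Cantor}
    (hlen : p.length ≤ u.length) (h : appendSeq u y = appendSeq p x) :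
    ∃ u', u = p ++ u' ∧ x = appendSeq u' y := by
  induction p generalizing u with
  | nil => exact ⟨u, rfl, by rw [h, appendSeq_nil]⟩
  | cons b p ih =>
    cases u with
    | nil => simp at hlen
    | cons c u =>
      obtain ⟨rfl, htail⟩ := appendSeq_cons_inj.1 h
      obtain ⟨u', rfl, hx⟩ := ih (by simpa using hlen) htail
      exact ⟨u', rfl, hx⟩

lemma appendSeq_inj_of_length_eq {u v : List Bool} {x y : Cantor} (hlen : u.length = v.length)
    (h : appendSeq u x = appendSeq v y) : u = v := by
  obtain ⟨u', rfl, -⟩ := exists_eq_append_of_appendSeq_eq hlen.ge h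
  simpa using hlen

lemma appendSeq_ofFn_shift (N : ℕ) (x : Cantor) :
    appendSeq (List.ofFn fun i : Fin N => x i) (fun n => x (N + n)) = x := by
  funext n
  by_cases h : n < N
  · simp [appendSeq, h]
  · simp [appendSeq, h, Nat.add_sub_cancel' (not_lt.1 h)]

/-- A self-map of the Cantor space replaces prefixes if it acts on every sufficiently small
cylinder by exchanging the prefix. -/
def ReplacesPrefixes (f : Cantor → Cantor) : Prop :=
  ∃ N : ℕ, ∀ u : List Bool, N ≤ u.length → ∃ v, ∀ y, f (appendSeq u y) = appendSeq v y

namespace ReplacesPrefixes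

lemma id : ReplacesPrefixes id :=
  ⟨0, fun u _ => ⟨u, fun _ => rfl⟩⟩

lemma comp {f g : Cantor → Cantor} (hf : ReplacesPrefixes f) (hg : ReplacesPrefixes g) :
    ReplacesPrefixes (f ∘ g) := by
  obtain ⟨M, hf⟩ := hf
  obtain ⟨N, hg⟩ := hg
  refine ⟨N + M, fun u hu => ?_⟩
  obtain ⟨v, hv⟩ := hg (u.take N) (by rw [List.length_take]; omega)
  obtain ⟨w, hw⟩ := hf (v ++ u.drop N) (by rw [List.length_append, List.length_drop]; omega)
  refine ⟨w, fun y => ?_⟩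
  rw [← hw, appendSeq_append, ← hv, ← appendSeq_append, List.take_append_drop, Function.comp]

lemma continuous {f : Cantor → Cantor} (hf : ReplacesPrefixes f) : Continuous f := by
  obtain ⟨N, hf⟩ := hf
  refine continuous_iff_continuousAt.2 fun x => ?_
  obtain ⟨v, hv⟩ := hf (List.ofFn fun i : Fin N => x i) (by simp)
  have hcont : Continuous fun z : Cantor => appendSeq v fun n => z (N + n) := by
    refine continuous_pi fun n => ?_
    by_cases h : n < v.length
    · simpa [appendSeq, h] using continuous_const
    · simpa [appendSeq, h] using continuous_apply (N + (n - v.length))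
  have hnhds : ∀ᶠ z in nhds x, ∀ i : Fin N, z i = x i :=
    Filter.eventually_all.2 fun i =>
      (continuous_apply (i : ℕ)).continuousAt.eventually_mem
        ((isOpen_discrete {x i}).mem_nhds rfl)
  refine hcont.continuousAt.congr ?_
  filter_upwards [hnhds] with z hz
  rw [← hv, ← funext hz, appendSeq_ofFn_shift]

lemma isPrefixExchange {f : Cantor ≃ₜ Cantor} (hf : ReplacesPrefixes f) :
    IsPrefixExchange f := by
  obtain ⟨N, hf⟩ := hf
  let e := Fintype.equivFin (Fin N → Bool)
  let u : Fin (Fintype.card (Fin N → Bool)) → List Bool := fun i => List.ofFn (e.symm i)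
  have hu : ∀ i, (u i).length = N := fun i => by simp [u]
  choose v hv using fun i => hf (u i) (hu i).ge
  have himage : ∀ i, cylinder (v i) = f '' cylinder (u i) := fun i => by
    rw [cylinder, cylinder, ← Set.range_comp]
    exact congrArg Set.range (funext fun y => (hv i y).symm)
  have hdisj : (Set.univ : Set (Fin _)).PairwiseDisjoint fun i => cylinder (u i) := by
    intro i _ j _ hij
    refine Set.disjoint_left.2 ?_
    rintro _ ⟨x, rfl⟩ ⟨y, hy⟩
    have := appendSeq_inj_of_length_eq ((hu j).trans (hu i).symm) hy
    exact hij (e.symm.injective (List.ofFn_injective this)).symm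
  have hcover : ⋃ i, cylinder (u i) = Set.univ := by
    refine Set.eq_univ_of_forall fun x => Set.mem_iUnion.2 ⟨e fun i => x i, fun n => x (N + n), ?_⟩
    simp only [u, Equiv.symm_apply_apply]
    exact appendSeq_ofFn_shift N x
  refine ⟨_, Fintype.card_pos, u, v, hdisj, hcover, ?_, ?_, hv⟩
  · intro i hi j hj hij
    simp only [Function.onFun, himage]
    exact (Set.disjoint_image_iff f.injective).2 (hdisj hi hj hij)
  · simp only [himage]
    rw [← Set.image_iUnion, hcover, Set.image_univ, f.surjective.range_eq]

/-- A map replaces prefixes if it does so relative to a finite complete prefix code. -/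
lemma of_code {Q : Type*} [Finite Q] {p v : Q → List Bool} {f : Cantor → Cantor}
    {k : Q → Cantor → Cantor} (hp : ∀ x, ∃ q y, appendSeq (p q) y = x)
    (hk : ∀ q, ReplacesPrefixes (k q))
    (hf : ∀ q y, f (appendSeq (p q) y) = appendSeq (v q) (k q y)) : ReplacesPrefixes f := by
  choose N hN using hk
  obtain ⟨B, hB⟩ := (Set.finite_range fun q => (p q).length + N q).bddAbove
  have hB : ∀ q, (p q).length + N q ≤ B := fun q => hB ⟨q, rfl⟩
  refine ⟨B, fun u hu => ?_⟩
  obtain ⟨q, y₀, hq⟩ := hp (appendSeq u fun _ => false)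
  have := hB q
  obtain ⟨u', rfl, -⟩ := exists_eq_append_of_appendSeq_eq (by omega) hq.symm
  obtain ⟨v', hv'⟩ := hN q u' (by rw [List.length_append] at hu; omega)
  exact ⟨v q ++ v', fun y => by rw [appendSeq_append, hf, hv', ← appendSeq_append]⟩

end ReplacesPrefixes

lemma exists_code_fin (n : ℕ) : ∃ p : Fin (n + 1) → List Bool,
    Function.Bijective fun a : Fin (n + 1) × Cantor => appendSeq (p a.1) a.2 := by
  induction n with
  | zero =>
    refine ⟨fun _ => [], fun a b h => Prod.ext (Subsingleton.elim (α := Fin 1) _ _) ?_,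
      fun x => ⟨(0, x), ?_⟩⟩
    · simpa only [appendSeq_nil] using h
    · exact appendSeq_nil x
  | succ n ih =>
    obtain ⟨p, hinj, hsurj⟩ := ih
    refine ⟨Fin.cases [false] fun i => true :: p i, ?_, fun x => ?_⟩
    · rintro ⟨i, x⟩ ⟨j, y⟩ h
      induction i using Fin.cases <;> induction j using Fin.cases <;>
        obtain ⟨h₁, h₂⟩ := appendSeq_cons_inj.1 h
      · simpa only [appendSeq_nil, Prod.mk.injEq, true_and] using h₂
      · simp at h₁
      · simp at h₁
      · rename_i i j
        have := hinj (a₁ := (i, x)) (a₂ := (j, y)) h₂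
        simpa using this
    · rw [← appendSeq_ofFn_shift 1 x]
      cases hx : x 0
      · exact ⟨(0, _), by simp [hx]; rfl⟩
      · obtain ⟨⟨i, y⟩, hy⟩ := hsurj fun n => x (1 + n)
        refine ⟨(i.succ, y), ?_⟩
        simp only [Fin.cases_succ, List.ofFn_succ, List.ofFn_zero, appendSeq_cons_inj]
        exact ⟨hx.symm, by rw [appendSeq_nil]; exact hy⟩

/-- Every finite nonempty type indexes a complete prefix code. -/
lemma exists_code (Q : Type*) [Finite Q] [Nonempty Q] : ∃ p : Q → List Bool,
    Function.Bijective fun a : Q × Cantor => appendSeq (p a.1) a.2 := by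
  obtain ⟨n, hn⟩ := Nat.exists_eq_succ_of_ne_zero (Nat.card_pos (α := Q)).ne'
  let e : Q ≃ Fin (n + 1) := (Finite.equivFin Q).trans (finCongr hn)
  obtain ⟨p, hp⟩ := exists_code_fin n
  exact ⟨p ∘ e, hp.comp (e.prodCongr (Equiv.refl Cantor)).bijective⟩

/-- The group acts on the Cantor space by prefix replacements with a demonstration node. -/
def HasDemonstrationNode (G : Type*) [Group G] : Prop :=
  ∃ φ : G →* Equiv.Perm Cantor, (∀ g, ReplacesPrefixes (φ g)) ∧
    ∃ w : List Bool, ∀ g x y, φ g (appendSeq w x) = appendSeq w y → g = 1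

/-- The permutation with `00y ↦ 0y`, `01y ↦ 10y` and `1y ↦ 11y`. -/
def northSouth : Equiv.Perm Cantor where
  toFun x := match x 0, x 1 with
    | false, false => fun n => x (n + 1)
    | false, true => appendSeq [true, false] fun n => x (n + 2)
    | true, _ => appendSeq [true] x
  invFun x := match x 0, x 1 with
    | false, _ => appendSeq [false] x
    | true, false => appendSeq [false, true] fun n => x (n + 2)
    | true, true => fun n => x (n + 1)
  left_inv x := by
    funext n
    cases h₀ : x 0 <;> cases h₁ : x 1 <;> rcases n with _ | _ | n <;>
      simp [h₀, h₁, appendSeq]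
  right_inv x := by
    funext n
    cases h₀ : x 0 <;> cases h₁ : x 1 <;> rcases n with _ | _ | n <;>
      simp [h₀, h₁, appendSeq]

lemma replacesPrefixes_northSouth : ReplacesPrefixes northSouth := by
  refine ⟨2, fun u hu => ?_⟩
  match u, hu with
  | false :: false :: u, _ =>
    refine ⟨false :: u, fun y => ?_⟩
    funext n
    simp [northSouth, appendSeq_cons_succ, appendSeq_cons_zero]
  | false :: true :: u, _ =>
    refine ⟨true :: false :: u, fun y => ?_⟩
    funext n
    rcases n with _ | _ | n <;> simp [northSouth, appendSeq]
  | true :: b :: u, _ =>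
    refine ⟨true :: true :: b :: u, fun y => ?_⟩
    funext n
    rcases n with _ | _ | n <;> simp [northSouth, appendSeq]

lemma replacesPrefixes_northSouth_symm : ReplacesPrefixes northSouth.symm := by
  refine ⟨2, fun u hu => ?_⟩
  match u, hu with
  | false :: b :: u, _ =>
    refine ⟨false :: false :: b :: u, fun y => ?_⟩
    funext n
    rcases n with _ | _ | n <;> simp [northSouth, appendSeq]
  | true :: false :: u, _ =>
    refine ⟨false :: true :: u, fun y => ?_⟩
    funext n
    rcases n with _ | _ | n <;> simp [northSouth, appendSeq]
  | true :: true :: u, _ =>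
    refine ⟨true :: u, fun y => ?_⟩
    funext n
    rcases n with _ | _ | n <;> simp [northSouth, appendSeq]

lemma northSouth_pow_succ_apply_zero (n : ℕ) (x : Cantor) :
    (northSouth ^ (n + 1)) (appendSeq [false, true] x) 0 = true := by
  induction n with
  | zero => simp [northSouth, appendSeq]
  | succ n ih =>
    rw [pow_succ', Equiv.Perm.mul_apply]
    generalize (northSouth ^ (n + 1)) (appendSeq [false, true] x) = z at ih
    simp [northSouth, ih, appendSeq]

lemma replacesPrefixes_zpow {e : Equiv.Perm Cantor} (he : ReplacesPrefixes e)
    (he' : ReplacesPrefixes e.symm) (k : ℤ) : ReplacesPrefixes (e ^ k : Equiv.Perm Cantor) := by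
  induction k with
  | zero => exact ReplacesPrefixes.id
  | succ n ih => rw [zpow_add_one]; exact ih.comp he
  | pred n ih => rw [zpow_sub_one]; exact ih.comp he'

lemma hasDemonstrationNode_int : HasDemonstrationNode (Multiplicative ℤ) := by
  refine ⟨zpowersHom _ northSouth, fun g => ?_, [false, true], fun g x y h => ?_⟩
  · exact replacesPrefixes_zpow replacesPrefixes_northSouth replacesPrefixes_northSouth_symm
      g.toAdd
  · obtain ⟨k, rfl⟩ := Multiplicative.ofAdd.surjective g
    rw [zpowersHom_apply, toAdd_ofAdd] at h
    rcases k with (_ | n) | n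
    · rfl
    · have := northSouth_pow_succ_apply_zero n x
      rw [Int.ofNat_eq_natCast, zpow_natCast] at h
      rw [h, appendSeq_cons_zero] at this
      cases this
    · have := northSouth_pow_succ_apply_zero n y
      rw [zpow_negSucc, Equiv.Perm.inv_eq_iff_eq] at h
      rw [← h, appendSeq_cons_zero] at this
      cases this

lemma HasDemonstrationNode.of_subsingleton (G : Type*) [Group G] [Subsingleton G] :
    HasDemonstrationNode G :=
  ⟨1, fun _ => ReplacesPrefixes.id, [], fun g _ _ _ => Subsingleton.elim g 1⟩

lemma HasDemonstrationNode.of_mulEquiv {G G' : Type*} [Group G] [Group G'] (e : G ≃* G')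
    (h : HasDemonstrationNode G') : HasDemonstrationNode G := by
  obtain ⟨φ, hφ, w, hw⟩ := h
  exact ⟨φ.comp e.toMonoidHom, fun g => hφ (e g), w,
    fun g x y hg => e.map_eq_one_iff.1 (hw (e g) x y hg)⟩

section Induction

variable {G : Type*} [Group G] {H : Subgroup G}

/-- The cocycle comparing left translation by `g` with the chosen coset representatives. -/
noncomputable def cosetCocycle (g : G) (q : G ⧸ H) : H :=
  ⟨(g • q).out⁻¹ * (g * q.out), by
    rw [← QuotientGroup.eq, QuotientGroup.out_eq', ← smul_eq_mul, ← MulAction.Quotient.smul_coe,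
      QuotientGroup.out_eq']⟩

lemma cosetCocycle_one (q : G ⧸ H) : cosetCocycle 1 q = 1 :=
  Subtype.ext (by simp [cosetCocycle])

lemma cosetCocycle_mul (g g' : G) (q : G ⧸ H) :
    cosetCocycle (g * g') q = cosetCocycle g (g' • q) * cosetCocycle g' q :=
  Subtype.ext (by simp [cosetCocycle, mul_smul, mul_assoc])

/-- The action on `G ⧸ H × X` induced from an action of `H` on `X`. -/
noncomputable def inducedPermHom {X : Type*} (φ : H →* Equiv.Perm X) :
    G →* Equiv.Perm ((G ⧸ H) × X) :=
  letI : MulAction G ((G ⧸ H) × X) :=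
    { smul g a := (g • a.1, φ (cosetCocycle g a.1) a.2)
      one_smul a := Prod.ext (one_smul G a.1) (by
        change φ (cosetCocycle 1 a.1) a.2 = a.2
        rw [cosetCocycle_one, map_one, Equiv.Perm.one_apply])
      mul_smul g g' a := Prod.ext (mul_smul g g' a.1) (by
        change φ (cosetCocycle (g * g') a.1) a.2 = _
        rw [cosetCocycle_mul, map_mul, Equiv.Perm.mul_apply]
        rfl) }
  MulAction.toPermHom G ((G ⧸ H) × X)

lemma inducedPermHom_apply {X : Type*} (φ : H →* Equiv.Perm X) (g : G) (q : G ⧸ H) (x : X) :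
    inducedPermHom φ g (q, x) = (g • q, φ (cosetCocycle g q) x) :=
  rfl

lemma HasDemonstrationNode.of_finiteIndex [H.FiniteIndex] (h : HasDemonstrationNode H) :
    HasDemonstrationNode G := by
  obtain ⟨φ, hφ, w, hw⟩ := h
  obtain ⟨p, hp⟩ := exists_code (G ⧸ H)
  let E := Equiv.ofBijective _ hp
  have hE : ∀ q x, E (q, x) = appendSeq (p q) x := fun _ _ => rfl
  have key : ∀ g q x, E.permCongrHom (inducedPermHom φ g) (appendSeq (p q) x) =
      appendSeq (p (g • q)) (φ (cosetCocycle g q) x) := fun g q x => by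
    rw [← hE, ← hE, ← inducedPermHom_apply]
    simp [Equiv.permCongrHom]
  refine ⟨E.permCongrHom.toMonoidHom.comp (inducedPermHom φ), fun g => ?_,
    p ((1 : G) : G ⧸ H) ++ w, fun g x y hg => ?_⟩
  · refine ReplacesPrefixes.of_code (p := p) (fun x => ?_) (fun q => hφ (cosetCocycle g q))
      (key g)
    obtain ⟨⟨q, y⟩, h⟩ := E.surjective x
    exact ⟨q, y, h⟩
  · rw [appendSeq_append, appendSeq_append] at hg
    have hg := (key g _ _).symm.trans hg
    rw [← hE, ← hE, E.apply_eq_iff_eq, Prod.mk.injEq] at hg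
    have hc := congrArg Subtype.val (hw _ _ _ hg.2)
    simp only [cosetCocycle, hg.1, OneMemClass.coe_one] at hc
    exact right_eq_mul.1 (inv_mul_eq_one.1 hc)

end Induction

lemma HasDemonstrationNode.exists_homeomorph {G : Type*} [Group G] (h : HasDemonstrationNode G) :
    ∃ ψ : G →* (Cantor ≃ₜ Cantor),
      Function.Injective ψ ∧ (∀ g : G, IsPrefixExchange (ψ g)) ∧
      ∃ w : List Bool, ∀ g₁ g₂ : G,
        ((ψ g₁) '' cylinder w ∩ (ψ g₂) '' cylinder w).Nonempty ↔ g₁ = g₂ := by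
  obtain ⟨φ, hφ, w, hw⟩ := h
  let ψ : G →* (Cantor ≃ₜ Cantor) :=
    { toFun g := (hφ g).continuous.homeoOfEquivCompactToT2
      map_one' := Homeomorph.ext fun x => by
        change φ 1 x = x
        rw [map_one, Equiv.Perm.one_apply]
      map_mul' g g' := Homeomorph.ext fun x => by
        change φ (g * g') x = φ g (φ g' x)
        rw [map_mul, Equiv.Perm.mul_apply] }
  have hψ : ∀ g x, ψ g x = φ g x := fun _ _ => rfl
  refine ⟨ψ, (injective_iff_map_eq_one ψ).2 fun g hg => ?_,
    fun g => ReplacesPrefixes.isPrefixExchange (hφ g), w, fun g₁ g₂ => ⟨?_, ?_⟩⟩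
  · refine hw g (fun _ => false) (fun _ => false) ?_
    rw [← hψ, hg]
    rfl
  · rintro ⟨_, ⟨_, ⟨x, rfl⟩, rfl⟩, _, ⟨y, rfl⟩, h⟩
    rw [hψ, hψ] at h
    refine (inv_mul_eq_one.1 (hw (g₂⁻¹ * g₁) x y ?_)).symm
    rw [map_mul, Equiv.Perm.mul_apply, ← h, map_inv, Equiv.Perm.inv_eq_iff_eq]
  · rintro rfl
    rw [Set.inter_self]
    exact (Set.range_nonempty _).image _

/-- Every virtually cyclic group (a group with a cyclic subgroup of finite index)
embeds as a demonstrative subgroup of Thompson's group `V` (realized as the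
prefix-exchange homeomorphisms of the Cantor space), with a demonstration node. -/
theorem virtuallyCyclic_demonstrative_in_V {G : Type*} [Group G]
    (H : Subgroup G) (hfin : H.FiniteIndex) (hcyc : IsCyclic H) :
    ∃ ψ : G →* (Cantor ≃ₜ Cantor),
      Function.Injective ψ ∧ (∀ g : G, IsPrefixExchange (ψ g)) ∧
      ∃ w : List Bool, ∀ g₁ g₂ : G,
        ((ψ g₁) '' cylinder w ∩ (ψ g₂) '' cylinder w).Nonempty ↔ g₁ = g₂ := by
  refine HasDemonstrationNode.exists_homeomorph (.of_finiteIndex (H := H) ?_)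
  cases finite_or_infinite H
  · exact .of_finiteIndex (H := (⊥ : Subgroup H)) (.of_subsingleton _)
  · exact hasDemonstrationNode_int.of_mulEquiv intCyclicMulEquiv.symm
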